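/- arXiv:1203.4107 — 4 statements merged into one kernel-verified Lean document; each statement's English description precedes it below -/
import Mathlib

section
/- Let p and q be distinct odd primes, r ≥ 2 an integer, and n = pqr. For every admissible polynomial f_2, the polynomial F(z) = (1 − z)·Φ_q(−z^{pr}) + f_2(z)·Φ_p(−z^{qr}) is a Reinhardt polynomial for n. -/
open Polynomial

/-- The nonzero coefficients of `F`, read in order of increasing degree, alternate in sign:
any two nonzero coefficients with only zero coefficients strictly between them have
opposite signs. -/
def AltSigns (F : Polynomial ℤ) : Prop :=
  ∀ i j : ℕ, i < j → F.coeff i ≠ 0 → F.coeff j ≠ 0 →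
    (∀ k, i < k → k < j → F.coeff k = 0) → F.coeff j = -F.coeff i

/-- `F` is a Reinhardt polynomial for `n`: `F(0) = 1`, `deg F < n`, every coefficient lies
in `{-1, 0, 1}`, the nonzero coefficients read in order of increasing degree alternate in
sign beginning and ending with `+1` (so their number is odd), and `Φ_{2n} ∣ F`. -/
def IsReinhardt (n : ℕ) (F : Polynomial ℤ) : Prop :=
  F.coeff 0 = 1 ∧
  F.degree < (n : WithBot ℕ) ∧
  (∀ k, F.coeff k ∈ ({-1, 0, 1} : Set ℤ)) ∧
  AltSigns F ∧
  (∀ i, F.coeff i ≠ 0 → (∀ k, k < i → F.coeff k = 0) → F.coeff i = 1) ∧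
  (∀ i, F.coeff i ≠ 0 → (∀ k, i < k → F.coeff k = 0) → F.coeff i = 1) ∧
  Odd F.support.card ∧
  cyclotomic (2 * n) ℤ ∣ F

/-- The doubled coefficient sequence `u_F : ℤ/2nℤ → ℤ`: `u_F(k)` is the coefficient of
`z^k` in `F` for `0 ≤ k < n`, and `u_F(n + k) = -u_F(k)` for `0 ≤ k < n`. -/
def uF (n : ℕ) (F : Polynomial ℤ) (k : ZMod (2 * n)) : ℤ :=
  if k.val < n then F.coeff k.val else -F.coeff (k.val - n)

/-- `F` is `m`-antiperiodic: `u_F(k + m) = -u_F(k)` for all `k ∈ ℤ/2nℤ`. -/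
def Antiper (n : ℕ) (F : Polynomial ℤ) (m : ℕ) : Prop :=
  ∀ k : ZMod (2 * n), uF n F (k + (m : ZMod (2 * n))) = -uF n F k

/-- `F` is periodic: it is `(n/d)`-antiperiodic for some odd divisor `d > 1` of `n`. -/
def IsPeriodicR (n : ℕ) (F : Polynomial ℤ) : Prop :=
  ∃ d : ℕ, d ∣ n ∧ Odd d ∧ 1 < d ∧ Antiper n F (n / d)

/-- A block of length `L` of a coefficient sequence `v` is OK with leading sign `ε`:
all entries lie in `{-1, 0, 1}`, the number of nonzero entries is odd, consecutive nonzero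
entries alternate in sign, and the first nonzero entry equals `ε`. -/
def BlockOK (L : ℕ) (v : ℕ → ℤ) (ε : ℤ) : Prop :=
  (∀ i, i < L → v i ∈ ({-1, 0, 1} : Set ℤ)) ∧
  Odd (((Finset.range L).filter fun i => v i ≠ 0).card) ∧
  (∀ i j, i < j → j < L → v i ≠ 0 → v j ≠ 0 → (∀ k, i < k → k < j → v k = 0) →
    v j = -v i) ∧
  (∀ i, i < L → v i ≠ 0 → (∀ k, k < i → v k = 0) → v i = ε)

/-- `f₂ ∈ ℤ[z]` is admissible (for odd prime `q` and `r ≥ 2`): `deg f₂ < qr`, the constant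
coefficient is `0`, and the coefficients `c_1, …, c_{qr-1}` split into consecutive blocks
`A_1, B_1, …, A_t, B_t` of length `r` (with `t = (q-1)/2`) followed by a final block `C` of
length `r - 1`, each with an odd number of nonzero entries alternating in sign, the first
nonzero entry of each `A_i` and of `C` being `+1` and that of each `B_i` being `-1`. -/
def Admissible (q r : ℕ) (f₂ : Polynomial ℤ) : Prop :=
  f₂.degree < ((q * r : ℕ) : WithBot ℕ) ∧
  f₂.coeff 0 = 0 ∧
  (∀ b, b < q - 1 → BlockOK r (fun i => f₂.coeff (1 + b * r + i)) ((-1) ^ b)) ∧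
  BlockOK (r - 1) (fun i => f₂.coeff (1 + (q - 1) * r + i)) 1

/-- For entries in `{-1, 0, 1}`, the sum has the same parity as the number of nonzero entries. -/
theorem odd_card_filter_iff_odd_sum (s : Finset ℕ) (v : ℕ → ℤ)
    (hv : ∀ i ∈ s, v i ∈ ({-1, 0, 1} : Set ℤ)) :
    Odd ((s.filter fun i => v i ≠ 0).card) ↔ Odd (∑ i ∈ s, v i) := by
  induction s using Finset.induction_on with
  | empty => simp
  | insert a s ha ih =>
    have ih_s := ih fun i hi => hv i (Finset.mem_insert_of_mem hi)
    have h := hv a (Finset.mem_insert_self a s)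
    simp only [Set.mem_insert_iff, Set.mem_singleton_iff] at h
    rw [Finset.sum_insert ha, Finset.filter_insert]
    rcases h with h | h | h
    · rw [if_pos (by simp [h]), Finset.card_insert_of_notMem (by simp [ha]), h]
      grind
    · rw [if_neg (by simp [h]), h, zero_add]
      exact ih_s
    · rw [if_pos (by simp [h]), Finset.card_insert_of_notMem (by simp [ha]), h]
      grind

/-- A partial sum of an alternating block is `0` or the leading sign. -/
theorem BlockOK.sum_range_eq {L : ℕ} {v : ℕ → ℤ} {ε : ℤ} (h : BlockOK L v ε) {m : ℕ}
    (hm : m ≤ L) : ∑ i ∈ Finset.range m, v i = 0 ∨ ∑ i ∈ Finset.range m, v i = ε := by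
  obtain ⟨-, -, halt, hfirst⟩ := h
  have key : ((∀ i < m, v i = 0) ∧ ∑ i ∈ Finset.range m, v i = 0) ∨
      ∃ i < m, v i ≠ 0 ∧ (∀ k, i < k → k < m → v k = 0) ∧
        ((v i = ε ∧ ∑ i ∈ Finset.range m, v i = ε) ∨
          (v i = -ε ∧ ∑ i ∈ Finset.range m, v i = 0)) := by
    induction m with
    | zero => simp
    | succ m ih =>
      rw [Finset.sum_range_succ]
      by_cases hvm : v m = 0
      · rw [hvm, add_zero]
        rcases ih (by omega) with ⟨h0, hs⟩ | ⟨i, hi, hvi, hz, hs⟩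
        · left
          refine ⟨fun i hi => ?_, hs⟩
          rcases Nat.lt_succ_iff_lt_or_eq.mp hi with hi | rfl
          exacts [h0 i hi, hvm]
        · right
          refine ⟨i, by omega, hvi, fun k hk hk' => ?_, hs⟩
          rcases Nat.lt_succ_iff_lt_or_eq.mp hk' with hk' | rfl
          exacts [hz k hk hk', hvm]
      · right
        refine ⟨m, by omega, hvm, fun k hk hk' => by omega, ?_⟩
        rcases ih (by omega) with ⟨h0, hs⟩ | ⟨i, hi, hvi, hz, hs⟩
        · have := hfirst m (by omega) hvm h0
          left
          simp [this, hs]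
        · have := halt i m hi (by omega) hvi hvm hz
          rcases hs with ⟨hs, hs'⟩ | ⟨hs, hs'⟩
          · right
            rw [this, hs, hs']
            simp
          · left
            rw [this, hs, hs']
            simp
  rcases key with ⟨-, h⟩ | ⟨_, -, -, -, ⟨-, h⟩ | ⟨-, h⟩⟩
  exacts [Or.inl h, Or.inr h, Or.inl h]

/-- An alternating block with an odd number of nonzero entries sums to its leading sign. -/
theorem BlockOK.sum_range_self {L : ℕ} {v : ℕ → ℤ} {ε : ℤ} (h : BlockOK L v ε) :
    ∑ i ∈ Finset.range L, v i = ε := by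
  rcases h.sum_range_eq le_rfl with h0 | h1
  · have := (odd_card_filter_iff_odd_sum (Finset.range L) v
      fun i hi => h.1 i (Finset.mem_range.mp hi)).mp h.2.1
    simp [h0] at this
  · exact h1

/-- Partial sums of the coefficients of an admissible polynomial up to a block boundary. -/
theorem Admissible.sum_range_block {q r : ℕ} {f : ℤ[X]} (hf : Admissible q r f) {b : ℕ}
    (hb : b ≤ q - 1) :
    ∑ i ∈ Finset.range (1 + b * r), f.coeff i = if Even b then 0 else 1 := by
  obtain ⟨-, h0, hblock, -⟩ := hf
  induction b with
  | zero => simp [h0]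
  | succ b ih =>
    rw [show 1 + (b + 1) * r = (1 + b * r) + r by ring, Finset.sum_range_add,
      ih (by omega), (hblock b (by omega)).sum_range_self]
    rcases Nat.even_or_odd b with hb | hb
    · simp [hb, hb.neg_one_pow, Nat.even_add_one]
    · simp [Nat.not_even_iff_odd.mpr hb, hb.neg_one_pow, Nat.even_add_one]

/-- The coefficients of an admissible polynomial sum to `1`. -/
theorem Admissible.sum_range_mul {q r : ℕ} {f : ℤ[X]} (hf : Admissible q r f) (hq : Odd q)
    (hr : 0 < r) : ∑ i ∈ Finset.range (q * r), f.coeff i = 1 := by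
  obtain ⟨t, rfl⟩ := hq
  have hsplit : (2 * t + 1) * r = (1 + (2 * t + 1 - 1) * r) + (r - 1) := by
    obtain ⟨s, rfl⟩ := Nat.exists_eq_add_of_lt hr
    simp only [Nat.add_sub_cancel, Nat.zero_add]
    ring
  rw [hsplit, Finset.sum_range_add, hf.sum_range_block le_rfl, hf.2.2.2.sum_range_self]
  simp

/-- Partial sums of the coefficients of an admissible polynomial are `0` or `1`. -/
theorem Admissible.sum_range_eq {q r : ℕ} {f : ℤ[X]} (hf : Admissible q r f) (hq : Odd q)
    (hr : 0 < r) {m : ℕ} (hm : m < q * r) :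
    ∑ i ∈ Finset.range (m + 1), f.coeff i = 0 ∨ ∑ i ∈ Finset.range (m + 1), f.coeff i = 1 := by
  have hdm := Nat.div_add_mod' m r
  have hb : m / r < q := Nat.div_lt_of_lt_mul (by rwa [mul_comm])
  have hlt := Nat.mod_lt m hr
  have hsplit : m + 1 = (1 + m / r * r) + m % r := by omega
  rw [hsplit, Finset.sum_range_add, hf.sum_range_block (by omega)]
  rcases Nat.lt_or_ge (m / r) (q - 1) with h | h
  · have := (hf.2.2.1 _ h).sum_range_eq hlt.le
    rcases Nat.even_or_odd (m / r) with hb | hb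
    · simpa [hb, hb.neg_one_pow] using this
    · simp only [hb.neg_one_pow, Nat.not_even_iff_odd.mpr hb, if_false] at this ⊢
      omega
  · have hbq : m / r = q - 1 := by omega
    have heven : Even (q - 1) := hq.tsub_odd odd_one
    have := hf.2.2.2.sum_range_eq (m := m % r) (by omega)
    simpa [hbq, heven] using this

/-- Coefficients of an alternating concatenation of shifted copies of `f`. -/
theorem coeff_mul_sum_neg_X_pow {f : ℤ[X]} {N : ℕ} (hN : 0 < N) (hf : f.degree < (N : WithBot ℕ))
    (a k : ℕ) :
    (f * ∑ i ∈ Finset.range a, (-(X ^ N)) ^ i).coeff k =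
      if k < a * N then (-1) ^ (k / N) * f.coeff (k % N) else 0 := by
  have hterm : ∀ i, (f * (-(X ^ N)) ^ i).coeff k =
      if k / N = i then (-1) ^ (k / N) * f.coeff (k % N) else 0 := by
    intro i
    have h1 : f * (-(X ^ N)) ^ i = C ((-1) ^ i) * (f * X ^ (N * i)) := by
      rw [neg_pow, pow_mul]
      simp only [map_pow, map_neg, map_one]
      ring
    rw [h1, coeff_C_mul, coeff_mul_X_pow']
    have hdm := Nat.div_add_mod k N
    have hlt := Nat.mod_lt k hN
    split_ifs with h2 h3 h3
    · subst h3
      congr 2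
      omega
    · rw [coeff_eq_zero_of_degree_lt (hf.trans_le ?_), mul_zero]
      have h4 : i < k / N :=
        lt_of_le_of_ne ((Nat.le_div_iff_mul_le hN).mpr (by rwa [mul_comm])) (Ne.symm h3)
      have h5 : N * (i + 1) ≤ k := by
        rw [mul_comm]
        exact (Nat.le_div_iff_mul_le hN).mp h4
      have h6 : N ≤ k - N * i := by
        rw [mul_add, mul_one] at h5
        omega
      exact_mod_cast h6
    · exact absurd (by subst h3; exact Nat.mul_div_le k N) h2
    · simp
  rw [Finset.mul_sum, finsetSum_coeff, Finset.sum_congr rfl fun i _ => hterm i,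
    Finset.sum_ite_eq]
  simp only [Finset.mem_range, Nat.div_lt_iff_lt_mul hN]

/-- If all partial sums of the coefficients of `F` are `0` or `1`, starting and ending with `1`,
then `F` has the sign pattern of a Reinhardt polynomial. -/
theorem isReinhardt_of_sum_range {n : ℕ} {F : ℤ[X]}
    (hS : ∀ k, ∑ i ∈ Finset.range k, F.coeff i = 0 ∨ ∑ i ∈ Finset.range k, F.coeff i = 1)
    (h0 : F.coeff 0 = 1) (hn : ∀ k, n ≤ k → ∑ i ∈ Finset.range k, F.coeff i = 1)
    (hdvd : cyclotomic (2 * n) ℤ ∣ F) : IsReinhardt n F := by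
  have hstep : ∀ k, F.coeff k =
      ∑ i ∈ Finset.range (k + 1), F.coeff i - ∑ i ∈ Finset.range k, F.coeff i := by
    intro k
    rw [Finset.sum_range_succ]
    ring
  have hconst : ∀ i j, i ≤ j → (∀ k, i ≤ k → k < j → F.coeff k = 0) →
      ∑ m ∈ Finset.range j, F.coeff m = ∑ m ∈ Finset.range i, F.coeff m := by
    intro i j hij hz
    refine (Finset.sum_subset (Finset.range_mono hij) fun k hk hk' => ?_).symm
    simp only [Finset.mem_range] at hk hk'
    exact hz k (by omega) hk
  have hmem : ∀ k, F.coeff k ∈ ({-1, 0, 1} : Set ℤ) := by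
    intro k
    have h1 := hS k
    have h2 := hS (k + 1)
    have h3 := hstep k
    simp only [Set.mem_insert_iff, Set.mem_singleton_iff]
    omega
  have hzero : ∀ k, n ≤ k → F.coeff k = 0 := by
    intro k hk
    rw [hstep k, hn k hk, hn (k + 1) (by omega), sub_self]
  refine ⟨h0, (degree_lt_iff_coeff_zero F n).mpr hzero, hmem, ?_, ?_, ?_, ?_, hdvd⟩
  · intro i j hij hi hj hz
    have h1 := hconst (i + 1) j hij fun k hk hk' => hz k (by omega) hk'
    have h2 := hstep i
    have h3 := hstep j
    have h4 := hS i
    have h5 := hS (i + 1)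
    have h6 := hS (j + 1)
    omega
  · intro i hi hz
    have h1 := hconst 0 i (Nat.zero_le i) fun k _ hk => hz k hk
    have h2 := hstep i
    have h3 := hS (i + 1)
    simp only [Finset.range_zero, Finset.sum_empty] at h1
    omega
  · intro i hi hz
    have h1 := hconst (i + 1) (max (i + 1) n) (le_max_left _ _) fun k hk _ => hz k hk
    have h2 := hn (max (i + 1) n) (le_max_right _ _)
    have h3 := hstep i
    have h4 := hS i
    omega
  · have hsupp : F.support = (Finset.range n).filter fun i => F.coeff i ≠ 0 := by
      ext k
      simp only [mem_support_iff, Finset.mem_filter, Finset.mem_range]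
      exact ⟨fun h => ⟨not_le.mp fun hk => h (hzero k hk), h⟩, fun h => h.2⟩
    rw [hsupp, odd_card_filter_iff_odd_sum _ _ fun i _ => hmem i, hn n le_rfl]
    exact odd_one

/-- For an odd prime `q` and `N > 0`, the polynomial `Φ_{2qN}` divides `Φ_q(-z^N)`. -/
theorem cyclotomic_dvd_cyclotomic_comp_neg_X_pow {q N : ℕ} (hq : q.Prime) (hoq : Odd q)
    (hN : 0 < N) :
    cyclotomic (2 * (q * N)) ℤ ∣ (cyclotomic q ℤ).comp (-(X ^ N)) := by
  have hpos : 0 < 2 * (q * N) := by have := hq.pos; positivity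
  have hω := Complex.isPrimitiveRoot_exp (2 * (q * N)) hpos.ne'
  set ω := Complex.exp (2 * Real.pi * Complex.I / ((2 * (q * N) : ℕ) : ℂ))
  rw [cyclotomic_eq_minpoly hω hpos]
  refine minpoly.isIntegrallyClosed_dvd (hω.isIntegral hpos) ?_
  have hroot : ω ^ (q * N) = -1 := by
    have h1 : (ω ^ (q * N)) ^ 2 = 1 := by
      rw [← pow_mul, mul_comm (q * N) 2]
      exact hω.pow_eq_one
    rcases mul_self_eq_one_iff.mp ((sq _).symm.trans h1) with h | h
    · exfalso
      have := Nat.le_of_dvd (by omega) (hω.dvd_of_pow_eq_one _ h)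
      omega
    · exact h
  have hpow : (-(ω ^ N)) ^ q = 1 := by
    rw [hoq.neg_pow, ← pow_mul, mul_comm, hroot, neg_neg]
  have hne : -(ω ^ N) ≠ 1 := by
    intro h
    have h1 : ω ^ (2 * N) = 1 := by
      rw [mul_comm, pow_mul, neg_eq_iff_eq_neg.mp h]
      norm_num
    have h2 := Nat.le_of_dvd (by omega) (hω.dvd_of_pow_eq_one _ h1)
    have h3 := hq.two_le
    nlinarith
  have := Fact.mk hq
  have hgeom : (∑ i ∈ Finset.range q, (-(ω ^ N)) ^ i) = 0 := by
    have := geom_sum_mul (-(ω ^ N)) q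
    rw [hpow, sub_self] at this
    exact (mul_eq_zero.mp this).resolve_right (sub_ne_zero.mpr hne)
  rw [aeval_comp, cyclotomic_prime]
  simpa using hgeom

/-- Partial sums of the coefficients of `(1 - X) * Q` are the coefficients of `Q`. -/
theorem sum_range_coeff_one_sub_X_mul (Q : ℤ[X]) (k : ℕ) :
    ∑ i ∈ Finset.range (k + 1), ((1 - X) * Q).coeff i = Q.coeff k := by
  induction k with
  | zero => simp [mul_coeff_zero]
  | succ k ih =>
    rw [Finset.sum_range_succ, ih, sub_mul, one_mul, coeff_sub, coeff_X_mul]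
    ring

/-- Partial sums of the coefficients of an alternating concatenation of copies of an `f` with
constant coefficient `0` and coefficient sum `1`. -/
theorem sum_range_coeff_mul_sum_neg_X_pow {f : ℤ[X]} {M : ℕ} (hM : 0 < M)
    (hf : f.degree < (M : WithBot ℕ)) (h0 : f.coeff 0 = 0)
    (h1 : ∑ i ∈ Finset.range M, f.coeff i = 1) {a k : ℕ} (hk : k < a * M) :
    ∑ i ∈ Finset.range (k + 1), (f * ∑ i ∈ Finset.range a, (-(X ^ M)) ^ i).coeff i =
      if Even (k / M) then ∑ i ∈ Finset.range (k % M + 1), f.coeff i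
      else 1 - ∑ i ∈ Finset.range (k % M + 1), f.coeff i := by
  induction k with
  | zero => simp [coeff_mul_sum_neg_X_pow hM hf, h0]
  | succ k ih =>
    rw [Finset.sum_range_succ, ih (by omega), coeff_mul_sum_neg_X_pow hM hf, if_pos hk]
    by_cases hdvd : M ∣ k + 1
    · have hdiv : (k + 1) / M = k / M + 1 := Nat.succ_div_of_dvd hdvd
      have hmod : (k + 1) % M = 0 := Nat.mod_eq_zero_of_dvd hdvd
      have hmod' : k % M + 1 = M := by
        have e1 := Nat.div_add_mod k M
        have e2 := Nat.div_add_mod (k + 1) M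
        rw [hdiv, hmod, mul_add] at e2
        omega
      rw [hdiv, hmod, hmod', h1, h0]
      rcases Nat.even_or_odd (k / M) with h | h
      · simp [h, h0, Nat.even_add_one]
      · simp [Nat.not_even_iff_odd.mpr h, h0, Nat.even_add_one]
    · have hdiv : (k + 1) / M = k / M := Nat.succ_div_of_not_dvd hdvd
      have hmod : (k + 1) % M = k % M + 1 := by
        have e1 := Nat.div_add_mod k M
        have e2 := Nat.div_add_mod (k + 1) M
        rw [hdiv] at e2
        omega
      rw [hdiv, hmod, Finset.sum_range_succ _ (k % M + 1)]
      rcases Nat.even_or_odd (k / M) with h | h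
      · simp [h, h.neg_one_pow]
      · simp only [Nat.not_even_iff_odd.mpr h, h.neg_one_pow, if_false]
        ring

/-- For distinct odd primes `p, q`, an integer `r ≥ 2`, `n = pqr`, and any
admissible `f₂`, the polynomial `F(z) = (1-z)·Φ_q(-z^{pr}) + f₂(z)·Φ_p(-z^{qr})` is a
Reinhardt polynomial for `n`. -/
theorem construction_is_reinhardt (p q r : ℕ) (hp : p.Prime) (hq : q.Prime) (hop : Odd p)
    (hoq : Odd q) (hpq : p ≠ q) (hr : 2 ≤ r) (f₂ : Polynomial ℤ) (hf₂ : Admissible q r f₂) :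
    IsReinhardt (p * q * r)
      ((1 - X) * (cyclotomic q ℤ).comp (-(X ^ (p * r)))
        + f₂ * (cyclotomic p ℤ).comp (-(X ^ (q * r)))) := by
  have hr0 : 0 < r := by omega
  have hN : 0 < p * r := Nat.mul_pos hp.pos hr0
  have hM : 0 < q * r := Nat.mul_pos hq.pos hr0
  have hqN : q * (p * r) = p * q * r := by ring
  have hpM : p * (q * r) = p * q * r := by ring
  have hcomp : ∀ {ℓ : ℕ} (N : ℕ), ℓ.Prime → (cyclotomic ℓ ℤ).comp (-(X ^ N)) =
      ∑ i ∈ Finset.range ℓ, (-(X ^ N)) ^ i := by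
    intro ℓ N hℓ
    have := Fact.mk hℓ
    simp [cyclotomic_prime]
  have hdvd : cyclotomic (2 * (p * q * r)) ℤ ∣
      (1 - X) * (cyclotomic q ℤ).comp (-(X ^ (p * r)))
        + f₂ * (cyclotomic p ℤ).comp (-(X ^ (q * r))) := by
    refine dvd_add (Dvd.dvd.mul_left ?_ _) (Dvd.dvd.mul_left ?_ _)
    · rw [← hqN]
      exact cyclotomic_dvd_cyclotomic_comp_neg_X_pow hq hoq hN
    · rw [← hpM]
      exact cyclotomic_dvd_cyclotomic_comp_neg_X_pow hp hop hM
  rw [hcomp _ hq, hcomp _ hp] at hdvd ⊢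
  have hQ : ∀ k, (∑ i ∈ Finset.range q, (-(X ^ (p * r)) : ℤ[X]) ^ i).coeff k =
      if k < p * q * r then (-1) ^ (k / (p * r)) * (1 : ℤ[X]).coeff (k % (p * r)) else 0 := by
    intro k
    have h := coeff_mul_sum_neg_X_pow (f := 1) hN
      (by rw [degree_one]; exact_mod_cast hN) q k
    rwa [one_mul, hqN] at h
  set Q : ℤ[X] := ∑ i ∈ Finset.range q, (-(X ^ (p * r)) : ℤ[X]) ^ i
  set P : ℤ[X] := ∑ i ∈ Finset.range p, (-(X ^ (q * r)) : ℤ[X]) ^ i with hP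
  have hsum1 := hf₂.sum_range_mul hoq hr0
  have hH : ∀ k, k < p * q * r → ∑ i ∈ Finset.range (k + 1), (f₂ * P).coeff i =
      if Even (k / (q * r)) then ∑ i ∈ Finset.range (k % (q * r) + 1), f₂.coeff i
      else 1 - ∑ i ∈ Finset.range (k % (q * r) + 1), f₂.coeff i := fun k hk =>
    sum_range_coeff_mul_sum_neg_X_pow hM hf₂.1 hf₂.2.1 hsum1 (by rwa [hpM])
  have hS : ∀ k, ∑ i ∈ Finset.range (k + 1), ((1 - X) * Q + f₂ * P).coeff i =
      Q.coeff k + ∑ i ∈ Finset.range (k + 1), (f₂ * P).coeff i := by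
    intro k
    simp only [coeff_add, Finset.sum_add_distrib, sum_range_coeff_one_sub_X_mul]
  have hn0 : 0 < p * q * r := hpM ▸ Nat.mul_pos hp.pos hM
  have hlast : ∑ i ∈ Finset.range (p * q * r), (f₂ * P).coeff i = 1 := by
    have hidx : p * q * r - 1 = q * r * (p - 1) + (q * r - 1) := by
      have : q * r * (p - 1) + q * r = p * q * r := by
        rw [← Nat.mul_succ, Nat.succ_eq_add_one, Nat.sub_add_cancel hp.one_le]
        ring
      omega
    have hdiv : (p * q * r - 1) / (q * r) = p - 1 := by
      rw [hidx, Nat.mul_add_div hM, Nat.div_eq_of_lt (by omega), add_zero]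
    have hmod : (p * q * r - 1) % (q * r) = q * r - 1 := by
      rw [hidx, Nat.mul_add_mod, Nat.mod_eq_of_lt (by omega)]
    have h := hH (p * q * r - 1) (by omega)
    rw [hdiv, hmod, if_pos (hop.tsub_odd odd_one), Nat.sub_add_cancel hM,
      Nat.sub_add_cancel hn0] at h
    rw [h, hsum1]
  have hend : ∀ k, p * q * r ≤ k → ∑ i ∈ Finset.range k, (f₂ * P).coeff i = 1 := by
    intro k hk
    rw [← hlast]
    refine (Finset.sum_subset (Finset.range_mono hk) fun i _ hi => ?_).symm
    rw [hP, coeff_mul_sum_neg_X_pow hM hf₂.1, hpM, if_neg (by simpa using hi)]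
  have hHval : ∀ k, k < p * q * r → ∑ i ∈ Finset.range (k + 1), (f₂ * P).coeff i = 0 ∨
      ∑ i ∈ Finset.range (k + 1), (f₂ * P).coeff i = 1 := by
    intro k hk
    rw [hH k hk]
    have := hf₂.sum_range_eq hoq hr0 (Nat.mod_lt k hM)
    split_ifs <;> omega
  have hHmul : ∀ j, j < q → ∑ i ∈ Finset.range (p * r * j + 1), (f₂ * P).coeff i =
      if Even j then 0 else 1 := by
    intro j hj
    have hlt : p * r * j < p * q * r := by
      rw [← hqN, mul_comm q]
      exact Nat.mul_lt_mul_of_pos_left hj hN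
    have hre : p * r * j = p * j * r := by ring
    have hdiv : p * r * j / (q * r) = p * j / q := by
      rw [hre, Nat.mul_div_mul_right _ _ hr0]
    have hmod : p * r * j % (q * r) = p * j % q * r := by
      rw [hre, Nat.mul_mod_mul_right]
    have hb := Nat.mod_lt (p * j) hq.pos
    have hpar : Even j ↔ (Even (p * j / q) ↔ Even (p * j % q)) := by
      have h1 : Even (p * j) ↔ Even j := by
        simp [Nat.even_mul, Nat.not_even_iff_odd.mpr hop]
      have h2 : Even (q * (p * j / q) + p * j % q) ↔
          (Even (p * j / q) ↔ Even (p * j % q)) := by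
        simp [Nat.even_add, Nat.even_mul, Nat.not_even_iff_odd.mpr hoq]
      rw [← h1, ← h2, Nat.div_add_mod]
    rw [hH _ hlt, hdiv, hmod, add_comm _ 1, hf₂.sum_range_block (by omega)]
    by_cases h1 : Even (p * j / q) <;> by_cases h2 : Even (p * j % q) <;> simp [hpar, h1, h2]
  have hone : ∀ m, (1 : ℤ[X]).coeff m = if m = 0 then 1 else 0 := fun m => coeff_one
  refine isReinhardt_of_sum_range (fun k => ?_) ?_ (fun k hk => ?_) hdvd
  · rcases k with _ | k
    · simp
    rw [hS, hQ]
    split_ifs with hk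
    · rw [hone]
      split_ifs with hmod
      · have hkj : p * r * (k / (p * r)) = k := Nat.mul_div_cancel' (Nat.dvd_of_mod_eq_zero hmod)
        have hj : k / (p * r) < q := Nat.div_lt_of_lt_mul (by rwa [mul_comm, hqN])
        have h := hHmul _ hj
        rw [hkj] at h
        rw [h]
        rcases Nat.even_or_odd (k / (p * r)) with he | ho
        · simp [he, he.neg_one_pow]
        · simp [Nat.not_even_iff_odd.mpr ho, ho.neg_one_pow]
      · simpa using hHval k hk
    · right
      rw [hend _ (by omega), zero_add]
  · have h := hS 0
    have h' := hHmul 0 hq.pos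
    rw [hQ 0] at h
    simp only [mul_zero, zero_add] at h'
    rw [zero_add, h'] at h
    simpa [hn0, hp.ne_zero, hq.ne_zero, hr0.ne'] using h
  · obtain ⟨m, rfl⟩ : ∃ m, k = m + 1 := ⟨k - 1, by omega⟩
    rw [hS, hend _ hk, hQ]
    split_ifs with hm
    · have hmod : m % (p * r) ≠ 0 := by
        intro h
        have h1 : r ∣ m := (Dvd.intro_left p rfl).trans (Nat.dvd_of_mod_eq_zero h)
        have h2 : r ∣ m + 1 := by
          rw [show m + 1 = p * q * r by omega]
          exact Dvd.intro_left _ rfl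
        have h3 := Nat.le_of_dvd one_pos ((Nat.dvd_add_right h1).mp h2)
        omega
      simp [hone, hmod]
    · simp
end

section
/- Let p and q be distinct odd primes, r ≥ 2 an integer, n = pqr, and let f_2 be an admissible polynomial with blocks A_1, B_1, …, A_t, B_t, C. Set F(z) = (1 − z)·Φ_q(−z^{pr}) + f_2(z)·Φ_p(−z^{qr}). Then F is periodic (i.e., (n/d)-antiperiodic for some odd divisor d > 1 of n) if and only if for every i ∈ {1, …, t}, the block A_i equals C with a 0 appended and the block B_i equals the entrywise negation of C with a 0 appended. -/
open Polynomial

/-- A sequence on `ℕ` that changes sign under translation by `m`. -/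
def NatAntiper (m : ℕ) (G : ℕ → ℤ) : Prop :=
  ∀ k, G (k + m) = -G k

/-- The `m`-antiperiodic sequence that agrees with `c` on `0, …, m - 1`. -/
def antiExt (m : ℕ) (c : ℕ → ℤ) (k : ℕ) : ℤ :=
  (-1) ^ (k / m) * c (k % m)

theorem antiExt_antiper {m : ℕ} (hm : 0 < m) (c : ℕ → ℤ) : NatAntiper m (antiExt m c) := by
  intro k
  simp [antiExt, Nat.add_div_right _ hm, pow_succ]

theorem antiExt_of_lt {m k : ℕ} (hk : k < m) (c : ℕ → ℤ) : antiExt m c k = c k := by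
  simp [antiExt, Nat.div_eq_of_lt hk, Nat.mod_eq_of_lt hk]

namespace NatAntiper

variable {m r : ℕ} {G H : ℕ → ℤ}

theorem add_mul (h : NatAntiper m G) (a k : ℕ) : G (k + a * m) = (-1) ^ a * G k := by
  induction a with
  | zero => simp
  | succ a ih => rw [Nat.succ_mul, ← add_assoc, h, ih, pow_succ]; ring

theorem odd_mul (h : NatAntiper m G) {a : ℕ} (ha : Odd a) : NatAntiper (a * m) G := by
  intro k
  simp [h.add_mul, ha.neg_one_pow]

theorem add (hG : NatAntiper m G) (hH : NatAntiper m H) :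
    NatAntiper m fun k => G k + H k := by
  intro k
  simp only [hG k, hH k]
  ring

theorem add_shift (h : NatAntiper m G) (P : ℕ) :
    NatAntiper m fun k => G k + G (k + P) := by
  intro k
  simp only [h k, add_right_comm k m P, h (k + P)]
  ring

theorem of_coprime {p q : ℕ} (hop : Odd p) (hoq : Odd q) (hpq : p.Coprime q) (hq : 1 < q)
    (h₁ : NatAntiper (p * r) G) (h₂ : NatAntiper (q * r) G) : NatAntiper r G := by
  intro k
  obtain ⟨a, -, ha⟩ := Nat.exists_mul_mod_eq_one_of_coprime hpq hq
  have hb : p * a = q * (p * a / q) + 1 := by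
    have := Nat.div_add_mod (p * a) q
    omega
  generalize p * a / q = b at hb
  have hab : Odd (a + b) := by
    have := congrArg (Odd ·) hb
    simp only [Nat.odd_mul, Nat.odd_add_one, hop, hoq, true_and, eq_iff_iff] at this
    rw [Nat.odd_add, this, Nat.not_odd_iff_even]
  have e₁ := h₁.add_mul a k
  have e₂ := h₂.add_mul b (k + r)
  have : k + a * (p * r) = k + r + b * (q * r) := by
    linear_combination r * hb
  rw [this, e₂] at e₁
  have hs : ((-1 : ℤ) ^ b) * (-1) ^ b = 1 := by rw [← mul_pow]; simp
  have hs' : ((-1 : ℤ) ^ b) * (-1) ^ a = -1 := by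
    rw [← pow_add, add_comm, hab.neg_one_pow]
  linear_combination (-1) ^ b * e₁ - G (k + r) * hs + G k * hs'

end NatAntiper

theorem uF_natCast {n : ℕ} (hn : 0 < n) (F : ℤ[X]) (k : ℕ) :
    uF n F (k : ZMod (2 * n)) = antiExt n F.coeff k := by
  have h2n : k % (2 * n) < 2 * n := Nat.mod_lt _ (by omega)
  have key : antiExt n F.coeff k = antiExt n F.coeff (k % (2 * n)) := by
    have := (antiExt_antiper hn F.coeff).add_mul (2 * (k / (2 * n))) (k % (2 * n))
    rw [pow_mul] at this
    simp only [even_two, Even.neg_pow, one_pow, one_mul] at this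
    rw [← this]
    congr 1
    rw [mul_right_comm]
    exact (Nat.mod_add_div k (2 * n)).symm
  rw [key, uF, ZMod.val_natCast]
  split_ifs with h
  · rw [antiExt_of_lt h]
  · obtain ⟨j, hj⟩ := Nat.exists_eq_add_of_le' (not_lt.mp h)
    rw [hj, antiExt_antiper hn, antiExt_of_lt (by omega), Nat.add_sub_cancel]

theorem antiper_iff_natAntiper {n : ℕ} (hn : 0 < n) (F : ℤ[X]) (m : ℕ) :
    Antiper n F m ↔ NatAntiper m (antiExt n F.coeff) := by
  have : NeZero (2 * n) := ⟨by omega⟩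
  constructor
  · intro h k
    simpa [← Nat.cast_add, uF_natCast hn] using h k
  · intro h k
    rw [← ZMod.natCast_zmod_val k, ← Nat.cast_add, uF_natCast hn, uF_natCast hn]
    exact h _

theorem isPeriodicR_iff {n : ℕ} (hn : 0 < n) (F : ℤ[X]) :
    IsPeriodicR n F ↔
      ∃ l s, l.Prime ∧ Odd l ∧ n = l * s ∧ NatAntiper s (antiExt n F.coeff) := by
  constructor
  · rintro ⟨d, ⟨s, hs⟩, hdo, hd1, h⟩
    rw [antiper_iff_natAntiper hn, hs, Nat.mul_div_cancel_left _ (by omega), ← hs] at h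
    obtain ⟨l, hl, e, rfl⟩ := Nat.exists_prime_and_dvd hd1.ne'
    rw [Nat.odd_mul] at hdo
    exact ⟨l, e * s, hl, hdo.1, by rw [hs, mul_assoc], h.odd_mul hdo.2⟩
  · rintro ⟨l, s, hl, hlo, hs, h⟩
    refine ⟨l, ⟨s, hs⟩, hlo, hl.one_lt, ?_⟩
    rwa [antiper_iff_natAntiper hn, hs, Nat.mul_div_cancel_left _ hl.pos, ← hs]

theorem coeff_mul_cyclotomic_comp {m M : ℕ} (hM : M.Prime) {f : ℤ[X]}
    (hf : f.degree < (m : WithBot ℕ)) {k : ℕ} (hk : k < m * M) :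
    (f * (cyclotomic M ℤ).comp (-(X ^ m))).coeff k = antiExt m f.coeff k := by
  have : Fact M.Prime := ⟨hM⟩
  have hexp : f * (cyclotomic M ℤ).comp (-(X ^ m)) =
      ∑ j ∈ Finset.range M, C ((-1) ^ j) * (f * X ^ (m * j)) := by
    rw [cyclotomic_prime, Polynomial.comp, eval₂_finsetSum, Finset.mul_sum]
    refine Finset.sum_congr rfl fun j _ => ?_
    rw [eval₂_X_pow, neg_pow, ← pow_mul, C_pow, C_neg, C_1]
    ring
  rw [hexp, finsetSum_coeff, Finset.sum_eq_single (k / m)]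
  · rw [coeff_C_mul, coeff_mul_X_pow', if_pos (Nat.mul_div_le k m), antiExt,
      Nat.mod_eq_sub_mul_div]
  · intro j _ hj
    rw [coeff_C_mul, coeff_mul_X_pow']
    split_ifs with h
    · rw [coeff_eq_zero_of_degree_lt, mul_zero]
      refine hf.trans_le ?_
      norm_cast
      by_contra! hlt
      apply hj
      symm
      apply Nat.div_eq_of_lt_le <;> nlinarith [Nat.sub_add_cancel h]
    · simp
  · intro h
    exact absurd (Finset.mem_range.mpr (Nat.div_lt_of_lt_mul hk)) h

theorem antiExt_antiExt {m M : ℕ} (hm : 0 < m) (hM : Odd M) (c : ℕ → ℤ) (k : ℕ) :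
    antiExt (m * M) (antiExt m c) k = antiExt m c k := by
  have := ((antiExt_antiper hm c).odd_mul hM).add_mul (k / (m * M)) (k % (m * M))
  rw [antiExt, ← this]
  congr 1
  rw [mul_comm M m, mul_comm (k / _)]
  exact Nat.mod_add_div k (m * M)

/-- The antiperiodic extension of the coefficients of `1 - X`. -/
noncomputable def edgeSeq (m : ℕ) : ℕ → ℤ :=
  antiExt m (1 - X : ℤ[X]).coeff

theorem antiExt_construction {p q r : ℕ} (hp : p.Prime) (hq : q.Prime) (hop : Odd p)
    (hoq : Odd q) (hr : 2 ≤ r) {f : ℤ[X]} (hf : f.degree < ((q * r : ℕ) : WithBot ℕ)) :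
    antiExt (p * q * r) ((1 - X) * (cyclotomic q ℤ).comp (-(X ^ (p * r)))
          + f * (cyclotomic p ℤ).comp (-(X ^ (q * r)))).coeff
      = fun k => edgeSeq (p * r) k + antiExt (q * r) f.coeff k := by
  have hp0 := hp.pos
  have hq0 := hq.pos
  have hpr : 2 ≤ p * r := by nlinarith
  have hqr : 0 < q * r := by positivity
  have e₁ : p * q * r = p * r * q := by ring
  have e₂ : p * q * r = q * r * p := by ring
  have hdeg : (1 - X : ℤ[X]).degree < ((p * r : ℕ) : WithBot ℕ) := by
    refine lt_of_le_of_lt (b := ((1 : ℕ) : WithBot ℕ)) (by compute_degree!) ?_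
    exact_mod_cast hpr
  ext k
  have hk : k % (p * q * r) < p * q * r := Nat.mod_lt _ (by positivity)
  rw [antiExt, coeff_add, coeff_mul_cyclotomic_comp hq hdeg (e₁ ▸ hk),
    coeff_mul_cyclotomic_comp hp hf (e₂ ▸ hk), mul_add, edgeSeq]
  congr 1
  · rw [e₁]
    exact antiExt_antiExt (by omega) hoq _ k
  · rw [e₂]
    exact antiExt_antiExt hqr hop _ k

theorem edgeSeq_zero {m : ℕ} (hm : 2 ≤ m) : edgeSeq m 0 = 1 := by
  rw [edgeSeq, antiExt_of_lt (by omega)]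
  simp

theorem edgeSeq_one {m : ℕ} (hm : 2 ≤ m) : edgeSeq m 1 = -1 := by
  rw [edgeSeq, antiExt_of_lt (by omega)]
  simp [coeff_one]

theorem edgeSeq_ne_zero {m k : ℕ} (h : edgeSeq m k ≠ 0) : k % m = 0 ∨ k % m = 1 := by
  contrapose! h
  simp [edgeSeq, antiExt, coeff_one, coeff_X, h.1, h.2.symm]

theorem not_natAntiper_edgeSeq {p r : ℕ} (hp : 3 ≤ p) (hr : 2 ≤ r) :
    ¬ NatAntiper r (edgeSeq (p * r)) := by
  intro h
  have hpr : r + 1 < p * r := by nlinarith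
  have h0 := h 0
  rw [edgeSeq_zero (by omega), zero_add] at h0
  have := edgeSeq_ne_zero (m := p * r) (k := r) (by rw [h0]; decide)
  rw [Nat.mod_eq_of_lt (by omega)] at this
  omega

theorem not_natAntiper_edgeSeq_add_shift {p q l s : ℕ} (hp : p.Prime) (hq : q.Prime)
    (hl : l.Prime) (hop : Odd p) (hpl : p ≠ l) (hql : q ≠ l) (hr : 2 ≤ l * s) :
    ¬ NatAntiper (l * s)
      fun k => edgeSeq (p * (l * s)) k + edgeSeq (p * (l * s)) (k + p * q * s) := by
  intro h
  have hp3 : 3 ≤ p := by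
    have := hp.two_le
    have : p ≠ 2 := by rintro rfl; revert hop; decide
    omega
  have hpm : p ∣ p * (l * s) := dvd_mul_right _ _
  have hs : 0 < s := by
    rcases Nat.eq_zero_or_pos s with rfl | h
    · simp at hr
    · exact h
  have hm : l * s + 2 < p * (l * s) := by nlinarith
  have hP0 : ¬ p * (l * s) ∣ p * q * s := by
    rw [mul_assoc, Nat.mul_dvd_mul_iff_left hp.pos, Nat.mul_dvd_mul_iff_right hs,
      Nat.prime_dvd_prime_iff_eq hl hq]
    exact hql.symm
  have hrP0 : ¬ p * (l * s) ∣ l * s + p * q * s := by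
    intro h
    have : s * (p * l) ∣ s * (l + p * q) := by convert h using 1 <;> ring
    rw [Nat.mul_dvd_mul_iff_left hs] at this
    have := (Nat.dvd_add_left (dvd_mul_right p q)).mp ((dvd_mul_right p l).trans this)
    exact hpl ((Nat.prime_dvd_prime_iff_eq hp hl).mp this)
  have hpP : p ∣ p * q * s := ⟨q * s, by ring⟩
  have h0 := h 0
  have h1 := h 1
  simp only [zero_add] at h0 h1
  generalize hmdef : p * (l * s) = m at *
  generalize hPdef : p * q * s = P at *
  have modp : ∀ {a c}, a % m = c → a % p = c % p := by
    rintro a c rfl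
    exact (Nat.mod_mod_of_dvd a hpm).symm
  have hPp : P % p = 0 := Nat.mod_eq_zero_of_dvd hpP
  have zP : edgeSeq m P = 0 := by
    by_contra hne
    rcases edgeSeq_ne_zero hne with h | h
    · exact hP0 (Nat.dvd_of_mod_eq_zero h)
    · have := modp h
      rw [hPp, Nat.mod_eq_of_lt (by omega)] at this
      omega
  have zP1 : edgeSeq m (1 + P) = 0 := by
    by_contra hne
    rcases edgeSeq_ne_zero hne with h | h
    · have := modp h
      rw [Nat.add_mod, hPp, Nat.add_zero, Nat.mod_mod, Nat.mod_eq_of_lt (by omega)] at this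
      simp at this
    · refine hP0 ((Nat.modEq_zero_iff_dvd).mp (Nat.ModEq.add_left_cancel' 1 ?_))
      rw [Nat.ModEq, h, Nat.add_zero, Nat.mod_eq_of_lt (by omega)]
  have zr : edgeSeq m (l * s) = 0 := by
    by_contra hne
    have := edgeSeq_ne_zero hne
    rw [Nat.mod_eq_of_lt (by omega)] at this
    omega
  have zr1 : edgeSeq m (1 + l * s) = 0 := by
    by_contra hne
    have := edgeSeq_ne_zero hne
    rw [Nat.mod_eq_of_lt (by omega)] at this
    omega
  rw [edgeSeq_zero (by omega), zP, zr] at h0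
  rw [edgeSeq_one (by omega), zP1, zr1, add_assoc] at h1
  have c0 := edgeSeq_ne_zero (m := m) (k := l * s + P) (by omega)
  have c1 := edgeSeq_ne_zero (m := m) (k := 1 + (l * s + P)) (by omega)
  generalize l * s + P = x at *
  have hx : x % m = 1 := c0.resolve_left fun h => hrP0 (Nat.dvd_of_mod_eq_zero h)
  rw [Nat.add_mod, hx, Nat.mod_eq_of_lt (by omega : 1 < m), Nat.mod_eq_of_lt (by omega)] at c1
  omega

/-- Antiperiodicity with respect to the block length means that all blocks of `f` agree up to
the alternating sign with the last one, followed by a zero. -/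
theorem natAntiper_antiExt_iff {q r : ℕ} (hq : 0 < q) (hoq : Odd q) (hr : 2 ≤ r) (c : ℕ → ℤ)
    (hc : c 0 = 0) :
    NatAntiper r (antiExt (q * r) c) ↔
      ∀ b, b < q - 1 → ∀ i, i < r →
        c (1 + b * r + i)
          = (-1) ^ b * (if i < r - 1 then c (1 + (q - 1) * r + i) else 0) := by
  have hqr : (q - 1) * r + r = q * r := by
    obtain ⟨q, rfl⟩ := Nat.exists_eq_add_of_lt hq
    simp; ring
  have hev : Even (q - 1) := Nat.Odd.sub_odd hoq odd_one
  constructor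
  · intro h b hb i hi
    have hbr : b * r + r ≤ (q - 1) * r := by nlinarith
    have e : ∀ b j, antiExt (q * r) c (j + b * r) = (-1) ^ b * antiExt (q * r) c j :=
      h.add_mul
    split_ifs with hi'
    · have e₁ := e b (1 + i)
      have e₂ := e (q - 1) (1 + i)
      rw [antiExt_of_lt (by omega), antiExt_of_lt (by omega)] at e₁ e₂
      rw [hev.neg_one_pow, one_mul] at e₂
      rw [add_right_comm, e₁, add_right_comm, e₂]
    · have e₁ := e (b + 1) 0
      have hx : 0 + (b + 1) * r = 1 + b * r + i := by
        have : i = r - 1 := by omega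
        subst this
        rw [Nat.succ_mul]
        omega
      rw [hx, antiExt_of_lt (by omega), antiExt_of_lt (by omega), hc] at e₁
      simpa using e₁
  · intro h
    set w : ℕ → ℤ := fun i => if i = 0 then 0 else c ((q - 1) * r + i) with hw
    have key : ∀ x < q * r, c x = antiExt r w x := by
      intro x hx
      have hxq : x / r < q := (Nat.div_lt_iff_lt_mul (by omega)).mpr hx
      have hxr : x % r < r := Nat.mod_lt _ (by omega)
      have hdiv : x / r * r + x % r = x := Nat.div_add_mod' x r
      rw [antiExt]
      generalize x / r = b at *
      rcases hi : x % r with _ | i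
      · rw [hw]
        simp only [if_true, mul_zero]
        rcases b with _ | b
        · rwa [← hdiv, hi, zero_mul]
        · have := h b (by omega) (r - 1) (by omega)
          rw [if_neg (by omega), mul_zero] at this
          rw [← this]
          congr 1
          rw [← hdiv, hi, Nat.succ_mul]
          omega
      · rw [hi] at hdiv hxr
        rw [hw]
        simp only [Nat.succ_ne_zero, if_false]
        rcases Nat.lt_or_ge b (q - 1) with hb | hb
        · have := h b hb i (by omega)
          rw [if_pos (by omega)] at this
          rw [← hdiv, ← add_assoc, ← add_assoc, add_right_comm, add_comm _ 1, this,
            add_comm 1, add_right_comm]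
        · obtain rfl : b = q - 1 := by omega
          rw [hev.neg_one_pow, one_mul, hdiv]
    have : antiExt (q * r) c = antiExt r w := by
      ext k
      rw [← antiExt_antiExt (by omega) hoq w k, mul_comm r q, antiExt, antiExt,
        key _ (Nat.mod_lt _ (by positivity))]
    rw [this]
    exact antiExt_antiper (by omega) w

/-- With `p, q` distinct odd primes, `r ≥ 2`, `n = pqr`, and `f₂`
admissible with blocks `A_1, B_1, …, A_t, B_t, C`, the polynomial
`F(z) = (1-z)·Φ_q(-z^{pr}) + f₂(z)·Φ_p(-z^{qr})` is periodic if and only if every `A_i`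
equals `C` with a `0` appended and every `B_i` equals the negation of `C` with a `0`
appended. -/
theorem construction_periodic_iff (p q r : ℕ) (hp : p.Prime) (hq : q.Prime) (hop : Odd p)
    (hoq : Odd q) (hpq : p ≠ q) (hr : 2 ≤ r) (f₂ : Polynomial ℤ) (hf₂ : Admissible q r f₂) :
    IsPeriodicR (p * q * r)
        ((1 - X) * (cyclotomic q ℤ).comp (-(X ^ (p * r)))
          + f₂ * (cyclotomic p ℤ).comp (-(X ^ (q * r)))) ↔
      ∀ b, b < q - 1 → ∀ i, i < r →
        f₂.coeff (1 + b * r + i)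
          = (-1) ^ b * (if i < r - 1 then f₂.coeff (1 + (q - 1) * r + i) else 0) := by
  obtain ⟨hdeg, hc0, -, -⟩ := hf₂
  have hp0 := hp.pos
  have hq0 := hq.pos
  have hcop : p.Coprime q := (Nat.coprime_primes hp hq).mpr hpq
  have hE : NatAntiper (p * r) (edgeSeq (p * r)) := antiExt_antiper (by positivity) _
  have hG : NatAntiper (q * r) (antiExt (q * r) f₂.coeff) := antiExt_antiper (by positivity) _
  rw [isPeriodicR_iff (by positivity), antiExt_construction hp hq hop hoq hr hdeg,
    ← natAntiper_antiExt_iff hq0 hoq hr _ hc0]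
  constructor
  · rintro ⟨l, s, hl, -, hs, h⟩
    by_cases hlp : p = l
    · subst hlp
      exfalso
      obtain rfl : q * r = s := by
        apply Nat.eq_of_mul_eq_mul_left hp0
        rw [← hs, mul_assoc]
      have hE' : NatAntiper (q * r) (edgeSeq (p * r)) := by
        intro k
        linear_combination h k - hG k
      have hp3 : 3 ≤ p := by
        have := hp.two_le
        have : p ≠ 2 := by rintro rfl; revert hop; decide
        omega
      exact not_natAntiper_edgeSeq hp3 hr (.of_coprime hop hoq hcop hq.one_lt hE hE')
    by_cases hlq : q = l
    · subst hlq
      obtain rfl : p * r = s := by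
        apply Nat.eq_of_mul_eq_mul_left hq0
        rw [← hs]; ring
      have hG' : NatAntiper (p * r) (antiExt (q * r) f₂.coeff) := by
        intro k
        linear_combination h k - hE k
      exact .of_coprime hop hoq hcop hq.one_lt hG' hG
    · exfalso
      have hlr : l ∣ r := by
        have : l ∣ p * q * r := ⟨s, hs⟩
        rw [hl.dvd_mul, hl.dvd_mul, Nat.prime_dvd_prime_iff_eq hl hp,
          Nat.prime_dvd_prime_iff_eq hl hq] at this
        tauto
      obtain ⟨u, rfl⟩ := hlr
      obtain rfl : p * q * u = s := by
        apply Nat.eq_of_mul_eq_mul_left hl.pos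
        rw [← hs]; ring
      refine not_natAntiper_edgeSeq_add_shift hp hq hl hop hlp hlq hr
        (.of_coprime hop hoq hcop hq.one_lt (hE.add_shift _) ?_)
      intro k
      linear_combination h k + h (k + q * (l * u)) - hG.add_shift (p * q * u) k
  · intro h
    exact ⟨q, p * r, hq, hoq, by ring, hE.add (h.odd_mul hop)⟩
end

section
/- Let p and q be distinct odd primes and r ≥ 2 an integer. Let S and S′ be nonempty proper subsets of {0, 1, …, p−1}, set f_1(z) = Σ_{s∈S} (−1)^s z^{rs} (1 − z) and f_1′(z) = Σ_{s∈S′} (−1)^s z^{rs} (1 − z), and let f_2 and f_2′ be admissible polynomials. If f_1(z)·Φ_q(−z^{pr}) + f_2(z)·Φ_p(−z^{qr}) = f_1′(z)·Φ_q(−z^{pr}) + f_2′(z)·Φ_p(−z^{qr}), then S = S′ and f_2 = f_2′. -/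
open Polynomial

/-- An integer polynomial of degree `< p` vanishing at a primitive `p`-th root of unity
has all of its first `p` coefficients equal. -/
lemma coeff_eq_of_aeval_primitiveRoot_eq_zero {p : ℕ} (hp : p.Prime) {ζ : ℂ}
    (hζ : IsPrimitiveRoot ζ p) {G : ℤ[X]} (hdeg : G.degree < p) (hG : aeval ζ G = 0) :
    ∃ c : ℤ, ∀ i < p, G.coeff i = c := by
  have hdvd : cyclotomic p ℤ ∣ G := by
    rw [cyclotomic_eq_minpoly hζ hp.pos]
    exact minpoly.isIntegrallyClosed_dvd (hζ.isIntegral hp.pos) hG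
  obtain ⟨h, rfl⟩ := hdvd
  have : Fact p.Prime := ⟨hp⟩
  have hh : h.natDegree = 0 := by
    by_cases h0 : h = 0
    · simp [h0]
    · have hmul := (cyclotomic.monic p ℤ).natDegree_mul' h0
      rw [natDegree_cyclotomic, Nat.totient_prime hp] at hmul
      have := (natDegree_lt_iff_degree_lt (mul_ne_zero (cyclotomic_ne_zero p ℤ) h0)).2 hdeg
      have := hp.pos
      omega
  obtain ⟨c, rfl⟩ := natDegree_eq_zero.1 hh
  refine ⟨c, fun i hi => ?_⟩
  rw [coeff_mul_C, cyclotomic_prime]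
  simp [coeff_X_pow, hi]

/-- Two proper subsets of `{0, …, p-1}` are equal if the sums of the powers of a primitive
`p`-th root of unity over them agree. -/
lemma finset_eq_of_sum_primitiveRoot_pow_eq {p : ℕ} (hp : p.Prime) {ζ : ℂ}
    (hζ : IsPrimitiveRoot ζ p) {S S' : Finset ℕ} (hS : S ⊂ Finset.range p)
    (hS' : S' ⊂ Finset.range p) (h : ∑ s ∈ S, ζ ^ s = ∑ s ∈ S', ζ ^ s) : S = S' := by
  have hdeg : ∀ T ⊆ Finset.range p, (∑ s ∈ T, (X : ℤ[X]) ^ s).degree < p := by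
    intro T hT
    refine (degree_sum_le _ _).trans_lt ((Finset.sup_lt_iff (WithBot.bot_lt_coe p)).2 ?_)
    intro s hs
    rw [degree_X_pow]
    exact WithBot.coe_lt_coe.2 (Finset.mem_range.1 (hT hs))
  obtain ⟨c, hc⟩ := coeff_eq_of_aeval_primitiveRoot_eq_zero hp hζ
    (G := ∑ s ∈ S, X ^ s - ∑ s ∈ S', X ^ s)
    ((degree_sub_le _ _).trans_lt (max_lt (hdeg S hS.1) (hdeg S' hS'.1)))
    (by simp [h])
  simp only [coeff_sub, finsetSum_coeff, coeff_X_pow, Finset.sum_ite_eq] at hc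
  obtain ⟨a, ha, haS⟩ := Finset.exists_of_ssubset hS
  obtain ⟨b, hb, hbS'⟩ := Finset.exists_of_ssubset hS'
  have hca := hc a (Finset.mem_range.1 ha)
  have hcb := hc b (Finset.mem_range.1 hb)
  have hc0 : c = 0 := by
    simp only [haS, hbS', if_false] at hca hcb
    split_ifs at hca hcb <;> omega
  ext i
  by_cases hi : i < p
  · have := hc i hi
    split_ifs at this <;> simp_all
  · have hiS : i ∉ S := fun h => hi (Finset.mem_range.1 (hS.1 h))
    have hiS' : i ∉ S' := fun h => hi (Finset.mem_range.1 (hS'.1 h))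
    simp [hiS, hiS']

/-- With `p, q` distinct odd primes and `r ≥ 2`: if `S, S'` are nonempty
proper subsets of `{0, …, p-1}`, `f₁, f₁'` are the corresponding polynomials
`Σ_{s∈S} (-1)^s z^{rs}(1-z)`, and `f₂, f₂'` are admissible, then equality
`f₁·Φ_q(-z^{pr}) + f₂·Φ_p(-z^{qr}) = f₁'·Φ_q(-z^{pr}) + f₂'·Φ_p(-z^{qr})` forces `S = S'`
and `f₂ = f₂'`. -/
theorem general_construction_injective (p q r : ℕ) (hp : p.Prime) (hq : q.Prime)
    (hop : Odd p) (hoq : Odd q) (hpq : p ≠ q) (hr : 2 ≤ r)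
    (S S' : Finset ℕ) (hS : S.Nonempty) (hSp : S ⊂ Finset.range p)
    (hS' : S'.Nonempty) (hSp' : S' ⊂ Finset.range p)
    (f₂ f₂' : Polynomial ℤ) (hf₂ : Admissible q r f₂) (hf₂' : Admissible q r f₂')
    (heq : (∑ s ∈ S, (-1 : Polynomial ℤ) ^ s * X ^ (r * s) * (1 - X))
            * (cyclotomic q ℤ).comp (-(X ^ (p * r)))
          + f₂ * (cyclotomic p ℤ).comp (-(X ^ (q * r)))
        = (∑ s ∈ S', (-1 : Polynomial ℤ) ^ s * X ^ (r * s) * (1 - X))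
            * (cyclotomic q ℤ).comp (-(X ^ (p * r)))
          + f₂' * (cyclotomic p ℤ).comp (-(X ^ (q * r)))) :
    S = S' ∧ f₂ = f₂' := by
  obtain ⟨ζ, hζ⟩ : ∃ ζ : ℂ, IsPrimitiveRoot ζ p :=
    ⟨_, Complex.isPrimitiveRoot_exp p hp.ne_zero⟩
  obtain ⟨z, hz⟩ := IsAlgClosed.exists_pow_nat_eq (-ζ) (by omega : 0 < r)
  have hζp : ζ ^ p = 1 := hζ.pow_eq_one
  have hzp : -z ^ (p * r) = 1 := by
    rw [mul_comm, pow_mul, hz, hop.neg_pow, hζp, neg_neg]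
  have hzq : -z ^ (q * r) = ζ ^ q := by
    rw [mul_comm, pow_mul, hz, hoq.neg_pow, neg_neg]
  have hz1 : 1 - z ≠ 0 := by
    intro h
    obtain rfl : z = 1 := (sub_eq_zero.1 h).symm
    have : ζ = -1 := by rw [one_pow] at hz; rw [hz, neg_neg]
    rw [this, hop.neg_one_pow] at hζp
    norm_num at hζp
  have hΦq : aeval z ((cyclotomic q ℤ).comp (-(X ^ (p * r)))) = (q : ℂ) := by
    have : Fact q.Prime := ⟨hq⟩
    rw [aeval_comp, map_neg, map_pow, aeval_X, hzp, cyclotomic_prime]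
    simp
  have hΦp : aeval z ((cyclotomic p ℤ).comp (-(X ^ (q * r)))) = 0 := by
    have hroot := (hζ.pow_of_coprime q ((Nat.coprime_primes hq hp).2 hpq.symm)).isRoot_cyclotomic
      hp.pos
    rw [aeval_comp, map_neg, map_pow, aeval_X, hzq, aeval_def, ← eval_map, algebraMap_int_eq,
      map_cyclotomic]
    exact hroot
  have hsum : ∀ T : Finset ℕ,
      aeval z (∑ s ∈ T, (-1 : ℤ[X]) ^ s * X ^ (r * s) * (1 - X))
        = (∑ s ∈ T, ζ ^ s) * (1 - z) := by
    intro T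
    rw [map_sum, Finset.sum_mul]
    refine Finset.sum_congr rfl fun s _ => ?_
    simp only [map_mul, map_pow, map_neg, map_one, map_sub, aeval_X]
    rw [pow_mul, hz, ← mul_pow, neg_one_mul, neg_neg]
  obtain rfl : S = S' := by
    have h := congrArg (aeval z) heq
    rw [map_add, map_add, map_mul, map_mul, map_mul, map_mul, hΦq, hΦp, hsum, hsum, mul_zero,
      mul_zero, add_zero, add_zero] at h
    exact finset_eq_of_sum_primitiveRoot_pow_eq hp hζ hSp hSp'
      (mul_right_cancel₀ hz1 (mul_right_cancel₀ (Nat.cast_ne_zero.2 hq.ne_zero) h))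
  refine ⟨rfl, mul_right_cancel₀ ?_ (add_left_cancel heq)⟩
  intro h
  have h0 := congrArg (eval 0) h
  have hqr : q * r ≠ 0 := mul_ne_zero hq.ne_zero (by omega)
  rw [eval_comp, eval_neg, eval_pow, eval_X, zero_pow hqr, neg_zero, ← coeff_zero_eq_eval_zero,
    cyclotomic_coeff_zero ℤ hp.one_lt] at h0
  simp at h0
end

section
/- Let p and q be distinct odd primes and r ≥ 2 an integer. Then the number of admissible polynomials f_2 ∈ ℤ[z] is exactly 2^{q(r−1)−1}. -/
open Polynomial

/-- The sum of the coefficients of `f` of degree at most `n`. -/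
def coeffSum (f : Polynomial ℤ) (n : ℕ) : ℤ := ∑ k ∈ Finset.range (n + 1), f.coeff k

lemma coeffSum_succ (f : Polynomial ℤ) (n : ℕ) :
    coeffSum f (n + 1) = coeffSum f n + f.coeff (n + 1) :=
  Finset.sum_range_succ _ _

lemma coeffSum_add (f : Polynomial ℤ) (m i : ℕ) :
    coeffSum f (m + i) = coeffSum f m + ∑ k ∈ Finset.range i, f.coeff (1 + m + k) := by
  unfold coeffSum
  rw [show m + i + 1 = (m + 1) + i by ring, Finset.sum_range_add, add_comm m 1]

lemma odd_card_filter_ne_zero_iff (L : ℕ) (v : ℕ → ℤ)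
    (hv : ∀ i, i < L → v i ∈ ({-1, 0, 1} : Set ℤ)) :
    Odd ((Finset.range L).filter fun i => v i ≠ 0).card ↔
      Odd (∑ k ∈ Finset.range L, v k) := by
  induction L with
  | zero => simp
  | succ n ih =>
    have ih := ih fun i hi => hv i (by omega)
    have hn := hv n (by omega)
    rw [Finset.sum_range_succ, Finset.range_add_one, Finset.filter_insert]
    simp only [Set.mem_insert_iff, Set.mem_singleton_iff] at hn
    rw [Nat.odd_iff, Int.odd_iff] at *
    split_ifs with h
    · rw [Finset.card_insert_of_notMem (by simp)]
      omega
    · omega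

/-- A block is OK exactly when its partial sums take only the values `0` and `ε` and its total
is `ε`. -/
lemma blockOK_iff (L : ℕ) (v : ℕ → ℤ) (ε : ℤ) (hε : ε = 1 ∨ ε = -1) :
    BlockOK L v ε ↔
      (∀ i, i ≤ L → ∑ k ∈ Finset.range i, v k = 0 ∨ ∑ k ∈ Finset.range i, v k = ε) ∧
        ∑ k ∈ Finset.range L, v k = ε := by
  constructor
  · rintro ⟨hv, hodd, halt, hfirst⟩
    have hε0 : ε ≠ 0 := by omega
    have key : ∀ i, i ≤ L →
        (∑ k ∈ Finset.range i, v k = 0 ∧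
          ((∀ k, k < i → v k = 0) ∨
            ∃ m, m < i ∧ v m = -ε ∧ ∀ k, m < k → k < i → v k = 0)) ∨
        (∑ k ∈ Finset.range i, v k = ε ∧
          ∃ m, m < i ∧ v m = ε ∧ ∀ k, m < k → k < i → v k = 0) := by
      intro i
      induction i with
      | zero => intro _; left; simp
      | succ n ih =>
        intro hn
        rw [Finset.sum_range_succ]
        by_cases h0 : v n = 0
        · have extend : ∀ m, (∀ k, m < k → k < n → v k = 0) →
              ∀ k, m < k → k < n + 1 → v k = 0 := by
            intro m hm k hk hk'
            rcases Nat.lt_succ_iff_lt_or_eq.mp hk' with h | rfl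
            exacts [hm k hk h, h0]
          rcases ih (by omega) with ⟨hs, hz | ⟨m, hm, hvm, hz⟩⟩ | ⟨hs, m, hm, hvm, hz⟩
          · refine Or.inl ⟨by omega, Or.inl fun k hk => ?_⟩
            rcases Nat.lt_succ_iff_lt_or_eq.mp hk with h | rfl
            exacts [hz k h, h0]
          · exact Or.inl ⟨by omega, Or.inr ⟨m, by omega, hvm, extend m hz⟩⟩
          · exact Or.inr ⟨by omega, m, by omega, hvm, extend m hz⟩
        · have tail : ∀ k, n < k → k < n + 1 → v k = 0 := by intros; omega
          rcases ih (by omega) with ⟨hs, hz | ⟨m, hm, hvm, hz⟩⟩ | ⟨hs, m, hm, hvm, hz⟩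
          · have := hfirst n (by omega) h0 hz
            exact Or.inr ⟨by omega, n, by omega, this, tail⟩
          · have := halt m n hm (by omega) (hvm ▸ neg_ne_zero.mpr hε0) h0 hz
            rw [hvm, neg_neg] at this
            exact Or.inr ⟨by rw [hs, this, zero_add], n, by omega, this, tail⟩
          · have := halt m n hm (by omega) (hvm ▸ hε0) h0 hz
            rw [hvm] at this
            exact Or.inl ⟨by rw [hs, this, add_neg_cancel], Or.inr ⟨n, by omega, this, tail⟩⟩
    refine ⟨fun i hi => (key i hi).imp And.left And.left, ?_⟩
    rw [odd_card_filter_ne_zero_iff L v hv, Int.odd_iff] at hodd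
    rcases key L le_rfl with h | h <;> omega
  · rintro ⟨hS, hL⟩
    have hsucc := Finset.sum_range_succ v
    have hv : ∀ i, i < L → v i ∈ ({-1, 0, 1} : Set ℤ) := by
      intro i hi
      have h1 := hS i (by omega)
      have h2 := hS (i + 1) (by omega)
      have h3 := hsucc i
      simp only [Set.mem_insert_iff, Set.mem_singleton_iff]
      omega
    refine ⟨hv, ?_, ?_, ?_⟩
    · rw [odd_card_filter_ne_zero_iff L v hv, hL]
      rcases hε with rfl | rfl <;> decide
    · intro i j hij hj hi0 hj0 hz
      have hconst : ∑ k ∈ Finset.range j, v k = ∑ k ∈ Finset.range (i + 1), v k := by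
        refine (Finset.sum_subset (by simpa using hij) fun k hk hk' => ?_).symm
        simp only [Finset.mem_range] at hk hk'
        exact hz k (by omega) hk
      have h1 := hS i (by omega)
      have h2 := hS (i + 1) (by omega)
      have h3 := hS (j + 1) (by omega)
      have h4 := hsucc i
      have h5 := hsucc j
      omega
    · intro i hi hi0 hz
      have h1 : ∑ k ∈ Finset.range i, v k = 0 :=
        Finset.sum_eq_zero fun k hk => hz k (Finset.mem_range.mp hk)
      have h2 := hS (i + 1) (by omega)
      have h3 := hsucc i
      omega

/-- Admissibility in terms of coefficient sums: these are all `0` or `1`, and are prescribed at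
the ends of the blocks. -/
lemma admissible_iff {q r : ℕ} (hq : Odd q) (hr : 2 ≤ r) (f : Polynomial ℤ) :
    Admissible q r f ↔
      f.degree < ((q * r : ℕ) : WithBot ℕ) ∧ f.coeff 0 = 0 ∧
      (∀ n, n < q * r → coeffSum f n = 0 ∨ coeffSum f n = 1) ∧
      (∀ b, b < q → coeffSum f (b * r) = ((b % 2 : ℕ) : ℤ)) ∧
      coeffSum f (q * r - 1) = 1 := by
  have hsign : ∀ b : ℕ, (b % 2 = 0 ∧ (-1 : ℤ) ^ b = 1) ∨ (b % 2 = 1 ∧ (-1 : ℤ) ^ b = -1) := by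
    intro b
    rcases Nat.even_or_odd b with h | h
    · exact Or.inl ⟨Nat.even_iff.mp h, h.neg_one_pow⟩
    · exact Or.inr ⟨Nat.odd_iff.mp h, h.neg_one_pow⟩
  have hq2 := Nat.odd_iff.mp hq
  have hqr : q * r - 1 = (q - 1) * r + (r - 1) := by
    obtain ⟨s, rfl⟩ : ∃ s, q = s + 1 := ⟨q - 1, by omega⟩
    rw [add_mul, Nat.add_sub_cancel]
    omega
  unfold Admissible
  refine and_congr_right fun _ => and_congr_right fun h0 => ?_
  have hblock : ∀ b, BlockOK r (fun i => f.coeff (1 + b * r + i)) ((-1) ^ b) ↔ _ := fun b =>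
    blockOK_iff r _ _ ((hsign b).imp And.right And.right)
  rw [blockOK_iff _ _ _ (Or.inl rfl)]
  simp only [hblock]
  have hsum : ∀ m i, ∑ k ∈ Finset.range i, f.coeff (1 + m + k) =
      coeffSum f (m + i) - coeffSum f m := fun m i => by rw [coeffSum_add]; ring
  simp only [hsum, ← hqr]
  constructor
  · rintro ⟨hB, hC, hCe⟩
    have hend : ∀ b, b < q → coeffSum f (b * r) = ((b % 2 : ℕ) : ℤ) := by
      intro b
      induction b with
      | zero => simp [coeffSum, h0]
      | succ b ih =>
        intro hb
        have h1 := ih (by omega)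
        have h2 := (hB b (by omega)).2
        have h3 := hsign b
        rw [add_one_mul]
        omega
    have hlast := hend (q - 1) (by omega)
    refine ⟨fun n hn => ?_, hend, by omega⟩
    have hdiv : n / r < q := Nat.div_lt_of_lt_mul (by rwa [mul_comm])
    have hmod := Nat.mod_lt n (show 0 < r by omega)
    have hn' : n / r * r + n % r = n := Nat.div_add_mod' n r
    have h1 := hend _ hdiv
    by_cases hb : n / r < q - 1
    · have h2 := (hB _ hb).1 (n % r) hmod.le
      have h3 := hsign (n / r)
      rw [hn'] at h2
      omega
    · have hb' : n / r = q - 1 := by omega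
      rw [hb'] at hn' h1
      have h2 := hC (n % r) (by omega)
      rw [hn'] at h2
      omega
  · rintro ⟨hT, hend, he⟩
    have hlast := hend (q - 1) (by omega)
    refine ⟨fun b hb => ?_, fun i hi => ?_, by omega⟩
    · have h1 := hend b (by omega)
      have h2 := hend (b + 1) (by omega)
      have h3 := hsign b
      rw [add_one_mul] at h2
      refine ⟨fun i hi => ?_, by omega⟩
      have hle : (b + 1) * r ≤ (q - 1) * r := Nat.mul_le_mul_right r (by omega)
      rw [add_one_mul] at hle
      have h4 := hT (b * r + i) (by omega)
      omega
    · have h4 := hT ((q - 1) * r + i) (by omega)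
      omega

/-- The polynomial without constant term and of degree less than `N` whose coefficient sums
are prescribed by `e`. -/
noncomputable def ofCoeffSum (N : ℕ) (e : ℕ → ℤ) : Polynomial ℤ :=
  ∑ k ∈ Finset.range (N - 1), monomial (k + 1) (e (k + 1) - e k)

lemma coeff_ofCoeffSum_zero (N : ℕ) (e : ℕ → ℤ) : (ofCoeffSum N e).coeff 0 = 0 := by
  simp [ofCoeffSum, coeff_monomial]

lemma coeff_ofCoeffSum_succ (N : ℕ) (e : ℕ → ℤ) (n : ℕ) :
    (ofCoeffSum N e).coeff (n + 1) = if n + 1 < N then e (n + 1) - e n else 0 := by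
  simp [ofCoeffSum, coeff_monomial, Nat.lt_sub_iff_add_lt, ite_sub_ite]

lemma degree_ofCoeffSum_lt (N : ℕ) (e : ℕ → ℤ) : (ofCoeffSum N e).degree < (N : WithBot ℕ) := by
  rw [degree_lt_iff_coeff_zero]
  rintro (_ | m) hm
  · exact coeff_ofCoeffSum_zero N e
  · rw [coeff_ofCoeffSum_succ, if_neg (by omega)]

lemma coeffSum_ofCoeffSum {N : ℕ} {e : ℕ → ℤ} (he : e 0 = 0) {n : ℕ} (hn : n < N) :
    coeffSum (ofCoeffSum N e) n = e n := by
  induction n with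
  | zero => simp [coeffSum, coeff_ofCoeffSum_zero, he]
  | succ n ih =>
    rw [coeffSum_succ, ih (by omega), coeff_ofCoeffSum_succ, if_pos hn]
    ring

/-- The degrees at which the coefficient sum of an admissible polynomial is unconstrained. -/
def freeDegrees (q r : ℕ) : Finset ℕ := (Finset.range (q * r - 1)).filter fun n => ¬ r ∣ n

lemma card_freeDegrees {q r : ℕ} (hq : 0 < q) (hr : 2 ≤ r) :
    (freeDegrees q r).card = q * (r - 1) - 1 := by
  have hmult : (Finset.range (q * r - 1)).filter (fun n => r ∣ n) =
      (Finset.range q).image (· * r) := by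
    ext n
    simp only [Finset.mem_filter, Finset.mem_range, Finset.mem_image]
    constructor
    · rintro ⟨hn, b, rfl⟩
      exact ⟨b, lt_of_mul_lt_mul_left (by rw [mul_comm r q]; omega) (Nat.zero_le r),
        mul_comm _ _⟩
    · rintro ⟨b, hb, rfl⟩
      have : (b + 1) * r ≤ q * r := Nat.mul_le_mul_right r hb
      rw [add_one_mul] at this
      exact ⟨by omega, dvd_mul_left _ _⟩
  have h := Finset.card_filter_add_card_filter_not (s := Finset.range (q * r - 1))
    (fun n => r ∣ n)
  rw [hmult, Finset.card_image_of_injective _ (mul_left_injective₀ (by omega)),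
    Finset.card_range, Finset.card_range] at h
  rw [freeDegrees, Nat.mul_sub, mul_one]
  omega

lemma admissible_ext {q r : ℕ} (hq : Odd q) (hr : 2 ≤ r) {f g : Polynomial ℤ}
    (hf : Admissible q r f) (hg : Admissible q r g)
    (h : ∀ n ∈ freeDegrees q r, (coeffSum f n = 1 ↔ coeffSum g n = 1)) : f = g := by
  obtain ⟨hfd, hf0, hfT, hfe, hfl⟩ := (admissible_iff hq hr f).mp hf
  obtain ⟨hgd, hg0, hgT, hge, hgl⟩ := (admissible_iff hq hr g).mp hg
  have hT : ∀ n, n < q * r → coeffSum f n = coeffSum g n := by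
    intro n hn
    by_cases hlast : n = q * r - 1
    · rw [hlast, hfl, hgl]
    by_cases hdvd : r ∣ n
    · obtain ⟨b, rfl⟩ := hdvd
      have hb : b < q := lt_of_mul_lt_mul_left (by rwa [mul_comm r q]) (Nat.zero_le r)
      rw [mul_comm, hfe b hb, hge b hb]
    · have h1 := h n (by simp only [freeDegrees, Finset.mem_filter, Finset.mem_range]; omega)
      have h2 := hfT n hn
      have h3 := hgT n hn
      omega
  ext n
  by_cases hn : n < q * r
  · cases n with
    | zero => rw [hf0, hg0]
    | succ n =>
      have h1 := hT n (by omega)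
      have h2 := hT (n + 1) hn
      rw [coeffSum_succ, coeffSum_succ] at h2
      omega
  · rw [(degree_lt_iff_coeff_zero _ _).mp hfd n (by omega),
      (degree_lt_iff_coeff_zero _ _).mp hgd n (by omega)]

lemma exists_admissible {q r : ℕ} (hq : Odd q) (hr : 2 ≤ r) (s : ℕ → Prop) :
    ∃ f, Admissible q r f ∧ ∀ n ∈ freeDegrees q r, (coeffSum f n = 1 ↔ s n) := by
  classical
  let e : ℕ → ℤ := fun n =>
    if n = q * r - 1 then 1 else if r ∣ n then ((n / r % 2 : ℕ) : ℤ) else if s n then 1 else 0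
  have hqr : ∀ b, b < q → b * r + 1 < q * r := by
    intro b hb
    have : (b + 1) * r ≤ q * r := Nat.mul_le_mul_right r hb
    rw [add_one_mul] at this
    omega
  have hmul : ∀ b, b < q → e (b * r) = ((b % 2 : ℕ) : ℤ) := by
    intro b hb
    have := hqr b hb
    simp only [e]
    rw [if_neg (by omega), if_pos (dvd_mul_left _ _), Nat.mul_div_cancel _ (by omega)]
  have h0 : e 0 = 0 := by simpa using hmul 0 hq.pos
  have hT : ∀ n, n < q * r → coeffSum (ofCoeffSum (q * r) e) n = e n := fun n hn =>
    coeffSum_ofCoeffSum h0 hn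
  refine ⟨ofCoeffSum (q * r) e, (admissible_iff hq hr _).mpr ⟨degree_ofCoeffSum_lt _ _,
    coeff_ofCoeffSum_zero _ _, fun n hn => ?_, fun b hb => ?_, ?_⟩, fun n hn => ?_⟩
  · rw [hT n hn]
    simp only [e]
    split_ifs <;> omega
  · have := hqr b hb
    rw [hT _ (by omega), hmul b hb]
  · have := hqr 0 hq.pos
    rw [hT _ (by omega)]
    simp only [e, if_true]
  · simp only [freeDegrees, Finset.mem_filter, Finset.mem_range] at hn
    rw [hT n (by omega)]
    simp only [e]
    rw [if_neg (by omega), if_neg hn.2]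
    split_ifs with h <;> simp [h]

/-- For distinct odd primes `p, q` and an integer `r ≥ 2`, the number of
admissible polynomials `f₂ ∈ ℤ[z]` is exactly `2^{q(r-1)-1}`. -/
theorem count_admissible (p q r : ℕ) (hp : p.Prime) (hq : q.Prime) (hop : Odd p)
    (hoq : Odd q) (hpq : p ≠ q) (hr : 2 ≤ r) :
    Nat.card {f₂ : Polynomial ℤ // Admissible q r f₂} = 2 ^ (q * (r - 1) - 1) := by
  let Ψ : {f : Polynomial ℤ // Admissible q r f} → Set (freeDegrees q r) :=
    fun f => {n | coeffSum f.1 n = 1}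
  have hΨ : Function.Bijective Ψ := by
    constructor
    · intro f g hfg
      exact Subtype.ext <| admissible_ext hoq hr f.2 g.2 fun n hn =>
        Set.ext_iff.mp hfg ⟨n, hn⟩
    · intro S
      obtain ⟨f, hf, hfS⟩ := exists_admissible hoq hr fun n => ∃ hn, (⟨n, hn⟩ : freeDegrees q r) ∈ S
      refine ⟨⟨f, hf⟩, Set.ext fun n => (hfS n n.2).trans ?_⟩
      exact ⟨fun ⟨_, h⟩ => h, fun h => ⟨n.2, h⟩⟩
  rw [Nat.card_eq_of_bijective Ψ hΨ, Nat.card_eq_fintype_card, Fintype.card_set,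
    Fintype.card_coe, card_freeDegrees hq.pos hr]
end
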